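/- Let m ≥ 2 be an integer, let η, h, λ be real-valued functions on (0, ∞), and for each real s ≥ 2 define M_s(r) = (m+s−2)·η(r) − m·h(r) − (s−2)·λ(r). Let p ≥ q ≥ 2 be real numbers. If M_q(r) ≤ 0 for all r > 0 and h(r) ≤ η(r) ≤ λ(r) for all r > 0, then M_p(r)/(p−1) ≤ M_q(r)/(q−1) for all r > 0. -/

import Mathlib

/-- If `M_q ≤ 0` and `h ≤ η ≤ λ` on `(0, ∞)`, then `M_p/(p−1) ≤ M_q/(q−1)` on
`(0, ∞)` for `p ≥ q ≥ 2`, where `M_s(r) = (m+s−2)·η(r) − m·h(r) − (s−2)·λ(r)`. -/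
theorem balance_function_quotient_inequality
    (m : ℕ) (hm : 2 ≤ m) (η h lam : ℝ → ℝ)
    (Ms : ℝ → ℝ → ℝ)
    (hMs : ∀ s r, Ms s r = ((m : ℝ) + s - 2) * η r - (m : ℝ) * h r - (s - 2) * lam r)
    (p q : ℝ) (hq : 2 ≤ q) (hpq : q ≤ p)
    (hMq : ∀ r > 0, Ms q r ≤ 0)
    (hhη : ∀ r > 0, h r ≤ η r)
    (hηlam : ∀ r > 0, η r ≤ lam r) :
    ∀ r > 0, Ms p r / (p - 1) ≤ Ms q r / (q - 1) := by
  intro r hr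
  have hA : 0 ≤ (p - q) * ((m : ℝ) * (η r - h r)) :=
    mul_nonneg (sub_nonneg.2 hpq) (mul_nonneg m.cast_nonneg (sub_nonneg.2 (hhη r hr)))
  have hB : 0 ≤ (p - q) * (lam r - η r) :=
    mul_nonneg (sub_nonneg.2 hpq) (sub_nonneg.2 (hηlam r hr))
  rw [div_le_div_iff₀ (by linarith) (by linarith), hMs, hMs]
  linarith
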